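/- Let D be a digraph on n vertices and m edges in which every directed cycle has length at least g (g ≥ 1), and suppose that the minimum size of a feedback arc set of D equals the maximum number of pairwise arc-disjoint directed cycles of D (as holds for planar digraphs by the Lucchesi–Younger theorem). Then D has an acyclic set of size at least 2n/3 − m/(3g). -/

import Mathlib

/-- The edges of the cyclic sequence of vertices `l` (with wraparound):
consecutive pairs `(v₁,v₂), ..., (v_{k-1},v_k), (v_k,v₁)`. -/
def cycleEdges {V : Type*} (l : List V) : List (V × V) := l.zip (l.rotate 1)

/-- `l` is a directed cycle of the digraph with edge set `E`: a nonempty cyclic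
sequence of distinct vertices all of whose consecutive edges (with wraparound)
belong to `E`. -/
def IsDicycle {V : Type*} (E : Finset (V × V)) (l : List V) : Prop :=
  l ≠ [] ∧ l.Nodup ∧ ∀ e ∈ cycleEdges l, e ∈ E

/-- `F` is a feedback arc set: every directed cycle contains an edge of `F`. -/
def IsFAS {V : Type*} (E F : Finset (V × V)) : Prop :=
  ∀ l : List V, IsDicycle E l → ∃ e ∈ cycleEdges l, e ∈ F

/-- `A` is an acyclic set: the subdigraph induced on `A` has no directed cycle. -/
def IsAcyclicSet {V : Type*} (E : Finset (V × V)) (A : Finset V) : Prop :=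
  ∀ l : List V, (∀ v ∈ l, v ∈ A) → ¬ IsDicycle E l

theorem exists_indep_aux {V : Type*} [DecidableEq V] (F : Finset (V × V))
    (hF : ∀ e ∈ F, e.1 ≠ e.2) :
    ∀ (n : ℕ) (S : Finset V), S.card = n → ∃ A : Finset V, A ⊆ S ∧
      (∀ e ∈ F, e.1 ∈ A → e.2 ∉ A) ∧
      2 * S.card ≤ 3 * A.card + (F.filter (fun e => e.1 ∈ S ∧ e.2 ∈ S)).card := by
  intro n
  induction n using Nat.strong_induction_on with
  | _ n ih =>
  intro S hS
  rcases S.eq_empty_or_nonempty with rfl | ⟨v, hv⟩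
  · exact ⟨∅, by simp⟩
  set G := F.filter (fun e => e.1 ∈ S ∧ e.2 ∈ S) with hG
  set N := G.filter (fun e => e.1 = v ∨ e.2 = v) with hN
  have hev := Finset.card_erase_add_one hv
  obtain ⟨A, hAS, hA, hc⟩ := ih (S.erase v).card (by omega) (S.erase v) rfl
  have hsplit : (F.filter (fun e => e.1 ∈ S.erase v ∧ e.2 ∈ S.erase v)).card + N.card = G.card := by
    rw [← Finset.card_filter_add_card_filter_not (s := G) (fun e => e.1 = v ∨ e.2 = v), add_comm]
    congr 2
    ext e
    simp only [hG, Finset.mem_filter, Finset.mem_erase]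
    tauto
  have hvA : v ∉ A := fun h => by simpa using hAS h
  by_cases h2 : 2 ≤ N.card
  · exact ⟨A, hAS.trans (Finset.erase_subset _ _), hA, by omega⟩
  by_cases h0 : N.card = 0
  · rw [Finset.card_eq_zero] at h0
    have hno : ∀ e ∈ F, e.1 ∈ S → e.2 ∈ S → e.1 ≠ v ∧ e.2 ≠ v := by
      intro e he h1 h2
      have : e ∉ N := by rw [h0]; simp
      simp only [hN, hG, Finset.mem_filter] at this
      tauto
    have hAS' : insert v A ⊆ S :=
      Finset.insert_subset hv (hAS.trans (Finset.erase_subset _ _))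
    refine ⟨insert v A, hAS', ?_, ?_⟩
    · intro e he h1 h2
      obtain ⟨h3, h4⟩ := hno e he (hAS' h1) (hAS' h2)
      exact hA e he ((Finset.mem_insert.1 h1).resolve_left h3)
        ((Finset.mem_insert.1 h2).resolve_left h4)
    · rw [Finset.card_insert_of_notMem hvA]
      omega
  have h1 : N.card = 1 := by omega
  obtain ⟨e₀, he₀⟩ := Finset.card_eq_one.1 h1
  have hm : e₀ ∈ N := by rw [he₀]; simp
  simp only [hN, hG, Finset.mem_filter] at hm
  obtain ⟨⟨hm1, hm2, hm3⟩, hm4⟩ := hm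
  obtain ⟨w, hwS, hwv, hw⟩ : ∃ w, w ∈ S ∧ w ≠ v ∧ (e₀ = (v, w) ∨ e₀ = (w, v)) := by
    have := hF e₀ hm1
    rcases e₀ with ⟨a, b⟩
    simp only at *
    rcases hm4 with rfl | rfl
    · exact ⟨b, hm3, this.symm, Or.inl rfl⟩
    · exact ⟨a, hm2, this, Or.inr rfl⟩
  have hwE : w ∈ S.erase v := Finset.mem_erase.2 ⟨hwv, hwS⟩
  have hew := Finset.card_erase_add_one hwE
  obtain ⟨B, hBS, hB, hcB⟩ := ih ((S.erase v).erase w).card (by omega) _ rfl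
  have hmono : (F.filter (fun e => e.1 ∈ (S.erase v).erase w ∧ e.2 ∈ (S.erase v).erase w)).card ≤
      (F.filter (fun e => e.1 ∈ S.erase v ∧ e.2 ∈ S.erase v)).card := by
    apply Finset.card_le_card
    intro e
    simp only [Finset.mem_filter, Finset.mem_erase]
    tauto
  have hvB : v ∉ B := fun h => by simpa using hBS h
  have hwB : w ∉ B := fun h => by simpa using hBS h
  have hBS' : insert v B ⊆ S := Finset.insert_subset hv
      (hBS.trans ((Finset.erase_subset _ _).trans (Finset.erase_subset _ _)))
  refine ⟨insert v B, hBS', ?_, ?_⟩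
  · intro e he h1 h2
    by_cases hev : e.1 = v ∨ e.2 = v
    · have : e ∈ N := by
        simp only [hN, hG, Finset.mem_filter]
        exact ⟨⟨he, hBS' h1, hBS' h2⟩, hev⟩
      rw [he₀, Finset.mem_singleton] at this
      subst this
      have hwI : w ∈ insert v B := by
        rcases hw with rfl | rfl
        · exact h2
        · exact h1
      exact hwB ((Finset.mem_insert.1 hwI).resolve_left hwv)
    · push Not at hev
      exact hB e he ((Finset.mem_insert.1 h1).resolve_left hev.1)
        ((Finset.mem_insert.1 h2).resolve_left hev.2)
  · rw [Finset.card_insert_of_notMem hvB]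
    omega

theorem cycleEdges_length_aux {V : Type*} (l : List V) : (cycleEdges l).length = l.length := by
  simp [cycleEdges]

theorem cycleEdges_nodup_aux {V : Type*} (l : List V) (h : l.Nodup) : (cycleEdges l).Nodup := by
  apply List.Nodup.of_map Prod.fst
  rw [cycleEdges, List.map_fst_zip (by simp)]
  exact h

theorem cycle_packing_aux {V : Type*} [DecidableEq V] (E : Finset (V × V)) (g : ℕ)
    (hgirth : ∀ l : List V, IsDicycle E l → g ≤ l.length)
    (H : Finset (List V)) (hH : ∀ l ∈ H, IsDicycle E l)
    (hd : (H : Set (List V)).Pairwise (fun l l' => ∀ e ∈ cycleEdges l, e ∉ cycleEdges l')) :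
    H.card * g ≤ E.card := by
  calc H.card * g ≤ ∑ l ∈ H, (cycleEdges l).toFinset.card := by
        rw [← smul_eq_mul]
        apply Finset.card_nsmul_le_sum
        intro l hl
        rw [List.toFinset_card_of_nodup (cycleEdges_nodup_aux l (hH l hl).2.1),
          cycleEdges_length_aux]
        exact hgirth l (hH l hl)
    _ = (H.biUnion (fun l => (cycleEdges l).toFinset)).card := by
        rw [Finset.card_biUnion]
        intro l hl l' hl' hne
        rw [Function.onFun, Finset.disjoint_left]
        intro e he he'
        exact hd hl hl' hne e (List.mem_toFinset.1 he) (List.mem_toFinset.1 he')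
    _ ≤ E.card := by
        apply Finset.card_le_card
        intro e he
        obtain ⟨l, hl, he⟩ := Finset.mem_biUnion.1 he
        exact (hH l hl).2.2 e (List.mem_toFinset.1 he)

theorem isFAS_self_aux {V : Type*} (E : Finset (V × V)) : IsFAS E E := by
  intro l hl
  have h : cycleEdges l ≠ [] := by
    intro h
    apply hl.1
    rw [← List.length_eq_zero_iff, ← cycleEdges_length_aux, h]
    rfl
  obtain ⟨e, he⟩ := List.exists_mem_of_ne_nil _ h
  exact ⟨e, he, hl.2.2 e he⟩

/-- A digraph on `n` vertices and `m` edges, in which every directed cycle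
has length at least `g ≥ 1`, and which has the Lucchesi–Younger property
(min feedback arc set = max arc-disjoint cycle packing), has an acyclic set of
size at least `2n/3 - m/(3g)`. -/
theorem acyclic_set_general {V : Type*} [Fintype V] [DecidableEq V]
    (E : Finset (V × V)) (hE : ∀ e ∈ E, e.1 ≠ e.2)
    (g : ℕ) (hg : 1 ≤ g)
    (hgirth : ∀ l : List V, IsDicycle E l → g ≤ l.length)
    (hLY : sInf {k : ℕ | ∃ F : Finset (V × V), F ⊆ E ∧ IsFAS E F ∧ F.card = k} =
           sSup {k : ℕ | ∃ H : Finset (List V), (∀ l ∈ H, IsDicycle E l) ∧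
             (H : Set (List V)).Pairwise
               (fun l l' => ∀ e ∈ cycleEdges l, e ∉ cycleEdges l') ∧
             H.card = k}) :
    ∃ A : Finset V, IsAcyclicSet E A ∧
      2 * (Fintype.card V : ℝ) / 3 - (E.card : ℝ) / (3 * g) ≤ (A.card : ℝ) := by
  obtain ⟨F, hFE, hFAS, hFc⟩ := Nat.sInf_mem
    (s := {k : ℕ | ∃ F : Finset (V × V), F ⊆ E ∧ IsFAS E F ∧ F.card = k})
    ⟨E.card, E, subset_rfl, isFAS_self_aux E, rfl⟩
  have hk : F.card ≤ E.card / g := by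
    rw [hFc, hLY]
    apply csSup_le
    · exact ⟨0, ∅, by simp⟩
    · rintro k ⟨H, hH, hd, rfl⟩
      exact (Nat.le_div_iff_mul_le hg).2 (cycle_packing_aux E g hgirth H hH hd)
  rw [Nat.le_div_iff_mul_le hg] at hk
  obtain ⟨A, -, hA, hc⟩ := exists_indep_aux F (fun e he => hE e (hFE he)) _ Finset.univ rfl
  refine ⟨A, ?_, ?_⟩
  · intro l hl hcyc
    obtain ⟨e, he, heF⟩ := hFAS l hcyc
    have he' := List.of_mem_zip (show (e.1, e.2) ∈ l.zip (l.rotate 1) from he)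
    exact hA e heF (hl _ he'.1) (hl _ (List.mem_rotate.1 he'.2))
  · simp only [Finset.mem_univ, and_self, Finset.filter_true, Finset.card_univ] at hc
    have hg' : (0 : ℝ) < g := by exact_mod_cast hg
    have hk' : (F.card : ℝ) ≤ E.card / g := by
      rw [le_div_iff₀ hg']
      exact_mod_cast hk
    have hc' : 2 * (Fintype.card V : ℝ) ≤ 3 * A.card + F.card := by exact_mod_cast hc
    have : (E.card : ℝ) / (3 * g) = E.card / g / 3 := by
      rw [div_div, mul_comm]
    rw [this]
    linarith
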